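/- arXiv:math/0505163 — 2 statements merged into one kernel-verified Lean document; each statement's English description precedes it below -/
import Mathlib

section
/- Let A > 0 and let h, f : ℝ → ℝ be twice continuously differentiable on [0, A], with h > 0 on the open interval (0, A), h(0) = h(A) = 0, h'(0) = 1, and h'(A) = -1. Suppose that for every r ∈ (0, A) the shrinking soliton equations -h''(r) = h(r)·(1 + f''(r)) and -h''(r) = h(r) + h'(r)·f'(r) hold. Then h''(r) = -h(r) for every r ∈ (0, A); in other words the Gauss curvature -h''/h of the metric dr² + h(r)² dθ² is identically equal to 1, so the metric is Einstein with positive constant curvature. -/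
open Set

/-- An antitone function on `[a, b]` taking equal values at the endpoints has zero derivative at
every interior point. -/
theorem AntitoneOn.deriv_eq_zero_of_endpoints_eq {F : ℝ → ℝ} {a b : ℝ}
    (hF : AntitoneOn F (Icc a b)) (hab : F a = F b) {r : ℝ} (hr : r ∈ Ioo a b) :
    deriv F r = 0 := by
  have hlt : a < b := hr.1.trans hr.2
  have hconst : F =ᶠ[nhds r] fun _ => F a := by
    filter_upwards [Ioo_mem_nhds hr.1 hr.2] with x hx
    have hx' := Ioo_subset_Icc_self hx
    have h1 := hF (left_mem_Icc.2 hlt.le) hx' hx'.1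
    have h2 := hF hx' (right_mem_Icc.2 hlt.le) hx'.2
    linarith
  rw [hconst.deriv_eq, deriv_const]

/-- At an interior point, a `C²` function on an interval has a second derivative. -/
theorem ContDiffOn.hasDerivAt_deriv_of_mem_Ioo {g : ℝ → ℝ} {a b : ℝ}
    (hg : ContDiffOn ℝ 2 g (Icc a b)) {r : ℝ} (hr : r ∈ Ioo a b) :
    HasDerivAt g (deriv g r) r ∧ HasDerivAt (deriv g) (deriv (deriv g) r) r := by
  have hd : ContDiffOn ℝ 1 (deriv g) (Ioo a b) :=
    (hg.mono Ioo_subset_Icc_self).deriv_of_isOpen isOpen_Ioo (by norm_num)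
  have hnhds := isOpen_Ioo.mem_nhds hr
  exact ⟨(((hg.mono Ioo_subset_Icc_self).differentiableOn (by norm_num)).differentiableAt
      hnhds).hasDerivAt,
    ((hd.differentiableOn (by norm_num)).differentiableAt hnhds).hasDerivAt⟩

/-- The derivative of a `C¹` function on `[a, b]` that is differentiable at both endpoints is
continuous on `[a, b]`. -/
theorem ContDiffOn.continuousOn_deriv_Icc {g : ℝ → ℝ} {a b : ℝ} (hab : a < b)
    (hg : ContDiffOn ℝ 1 g (Icc a b)) (ha : DifferentiableAt ℝ g a)
    (hb : DifferentiableAt ℝ g b) : ContinuousOn (deriv g) (Icc a b) := by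
  have hu := uniqueDiffOn_Icc hab
  refine (hg.continuousOn_derivWithin hu le_rfl).congr fun x hx => ?_
  have hx' : DifferentiableAt ℝ g x := by
    rcases hx.1.eq_or_lt with rfl | hax
    · exact ha
    rcases hx.2.eq_or_lt with rfl | hxb
    · exact hb
    · exact (hg.differentiableOn (by norm_num)).differentiableAt (Icc_mem_nhds hax hxb)
  exact (hx'.derivWithin (hu x hx)).symm

/-- ODE form of Proposition 2: the rotationally symmetric gradient shrinking
soliton equations force the Gauss curvature `-h''/h` to be identically `1`. -/
theorem shrinking_soliton_ode_constant_curvature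
    (A : ℝ) (hA : 0 < A) (h f : ℝ → ℝ)
    (hh : ContDiffOn ℝ 2 h (Icc 0 A))
    (hf : ContDiffOn ℝ 2 f (Icc 0 A))
    (hpos : ∀ r ∈ Ioo 0 A, 0 < h r)
    (h0 : h 0 = 0) (hA0 : h A = 0)
    (hd0 : deriv h 0 = 1) (hdA : deriv h A = -1)
    (heq1 : ∀ r ∈ Ioo 0 A, -(deriv (deriv h) r) = h r * (1 + deriv (deriv f) r))
    (heq2 : ∀ r ∈ Ioo 0 A, -(deriv (deriv h) r) = h r + deriv h r * deriv f r) :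
    ∀ r ∈ Ioo 0 A, deriv (deriv h) r = -h r := by
  have Hh := fun r (hr : r ∈ Ioo 0 A) => hh.hasDerivAt_deriv_of_mem_Ioo hr
  have Hf := fun r (hr : r ∈ Ioo 0 A) => hf.hasDerivAt_deriv_of_mem_Ioo hr
  obtain ⟨a, ha⟩ : ∃ a, ∀ r ∈ Ioo 0 A, deriv f r = a * h r := by
    have hquot : ∀ r ∈ Ioo 0 A, HasDerivAt (fun x => deriv f x / h x) 0 r := by
      intro r hr
      refine ((Hf r hr).2.div (Hh r hr).1 (hpos r hr).ne').congr_deriv ?_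
      rw [div_eq_zero_iff]
      left
      linarith [heq1 r hr, heq2 r hr]
    obtain ⟨a, ha⟩ := isOpen_Ioo.exists_is_const_of_deriv_eq_zero isPreconnected_Ioo
      (fun r hr => (hquot r hr).differentiableAt.differentiableWithinAt)
      (fun r hr => (hquot r hr).deriv)
    exact ⟨a, fun r hr => (div_eq_iff (hpos r hr).ne').1 (ha r hr)⟩
  have hcont : ContinuousOn (deriv h) (Icc 0 A) :=
    (hh.of_le (by norm_num)).continuousOn_deriv_Icc hA
      (differentiableAt_of_deriv_ne_zero (by simp [hd0]))
      (differentiableAt_of_deriv_ne_zero (by simp [hdA]))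
  have hE : ∀ r ∈ Ioo 0 A, HasDerivAt (fun x => a * (deriv h x ^ 2 + h x ^ 2))
      (-(2 * h r * (a * deriv h r) ^ 2)) r := by
    intro r hr
    refine ((((Hh r hr).2.pow 2).add ((Hh r hr).1.pow 2)).const_mul a).congr_deriv ?_
    have h2 := heq2 r hr
    rw [ha r hr] at h2
    rw [show deriv (deriv h) r = -(h r + deriv h r * (a * h r)) by linarith]
    push_cast
    ring
  have hanti : AntitoneOn (fun x => a * (deriv h x ^ 2 + h x ^ 2)) (Icc 0 A) := by
    refine antitoneOn_of_deriv_nonpos (convex_Icc 0 A)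
      (continuousOn_const.mul ((hcont.pow 2).add (hh.continuousOn.pow 2))) ?_ ?_ <;>
      rw [interior_Icc] <;> intro r hr
    · exact (hE r hr).differentiableAt.differentiableWithinAt
    · rw [(hE r hr).deriv]
      have := hpos r hr
      exact neg_nonpos.2 (by positivity)
  have hzero : ∀ r ∈ Ioo 0 A, a * deriv h r = 0 := by
    intro r hr
    have hd := hanti.deriv_eq_zero_of_endpoints_eq (by simp [h0, hA0, hd0, hdA]) hr
    rw [(hE r hr).deriv] at hd
    simpa [(hpos r hr).ne'] using hd
  intro r hr
  have h2 := heq2 r hr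
  rw [ha r hr] at h2
  linear_combination -h2 - h r * hzero r hr
end

section
/- Let A > 0, let a ∈ ℝ, and let h : ℝ → ℝ be twice continuously differentiable on [0, A] with h(0) = h(A) = 0, h'(0) = 1, h'(A) = -1, and h(r) > 0 for all r ∈ (0, A). If -h''(r) = h(r)·(1 + a·h'(r)) for every r ∈ [0, A], then a = 0. -/
open Set

/-- Key integration-by-parts step of Proposition 2: the boundary conditions
force the soliton constant `a` to vanish. -/
theorem soliton_constant_vanishes
    (A : ℝ) (hA : 0 < A) (a : ℝ) (h : ℝ → ℝ)
    (hh : ContDiffOn ℝ 2 h (Icc 0 A))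
    (h0 : h 0 = 0) (hA0 : h A = 0)
    (hd0 : deriv h 0 = 1) (hdA : deriv h A = -1)
    (hpos : ∀ r ∈ Ioo 0 A, 0 < h r)
    (heq : ∀ r ∈ Icc 0 A, -(deriv (deriv h) r) = h r * (1 + a * deriv h r)) :
    a = 0 := by
  have hC2 : ContDiffOn ℝ 2 h (Ioo 0 A) := hh.mono Ioo_subset_Icc_self
  have hdiff : ∀ r ∈ Icc 0 A, DifferentiableAt ℝ h r := by
    intro r hr
    rcases eq_endpoints_or_mem_Ioo_of_mem_Icc hr with rfl | rfl | hr
    · exact differentiableAt_of_deriv_ne_zero (by simp [hd0])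
    · exact differentiableAt_of_deriv_ne_zero (by simp [hdA])
    · exact (hC2.contDiffAt (isOpen_Ioo.mem_nhds hr)).differentiableAt (by norm_num)
  have hcont' : ContinuousOn (deriv h) (Icc 0 A) :=
    (hh.continuousOn_derivWithin (uniqueDiffOn_Icc hA) (by norm_num)).congr fun r hr ↦
      ((hdiff r hr).derivWithin (uniqueDiffOn_Icc hA r hr)).symm
  have hdiff' : ∀ r ∈ Ioo 0 A, DifferentiableAt ℝ (deriv h) r := fun r hr ↦
    ((hC2.deriv_of_isOpen (m := 1) isOpen_Ioo (by norm_num)).differentiableOn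
      (by norm_num)).differentiableAt (isOpen_Ioo.mem_nhds hr)
  -- The energy `h'² + h²` is monotone up to sign, with equal values at the two poles.
  let G : ℝ → ℝ := fun r ↦ -a * (deriv h r ^ 2 + h r ^ 2)
  have hG : ∀ r ∈ Ioo 0 A, HasDerivAt G (2 * h r * (a * deriv h r) ^ 2) r := by
    intro r hr
    have hr' := Ioo_subset_Icc_self hr
    refine ((((hdiff' r hr).hasDerivAt.pow 2).add
      ((hdiff r hr').hasDerivAt.pow 2)).const_mul (-a)).congr_deriv ?_
    push_cast
    linear_combination (2 * a * deriv h r) * heq r hr'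
  have hmono : MonotoneOn G (Icc 0 A) := by
    refine monotoneOn_of_deriv_nonneg (convex_Icc 0 A) ?_ ?_ ?_
    · exact continuousOn_const.mul ((hcont'.pow 2).add (hh.continuousOn.pow 2))
    · rw [interior_Icc]
      exact fun r hr ↦ (hG r hr).differentiableAt.differentiableWithinAt
    · rw [interior_Icc]
      intro r hr
      rw [(hG r hr).deriv]
      have := hpos r hr
      positivity
  have hends : G A = G 0 := by simp [G, h0, hA0, hd0, hdA]
  have hconst : ∀ r ∈ Icc 0 A, G r = G 0 := fun r hr ↦
    le_antisymm ((hmono hr (right_mem_Icc.2 hA.le) hr.2).trans_eq hends)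
      (hmono (left_mem_Icc.2 hA.le) hr hr.1)
  obtain ⟨c, hc, hc'⟩ := exists_deriv_eq_slope h (half_pos hA)
    (hh.continuousOn.mono (Icc_subset_Icc_right (half_le_self hA.le)))
    fun r hr ↦ (hdiff r ⟨hr.1.le, by linarith [hr.2]⟩).differentiableWithinAt
  have hcA : c ∈ Ioo 0 A := ⟨hc.1, by linarith [hc.2]⟩
  have hslope : 0 < deriv h c := by
    have := hpos (A / 2) ⟨half_pos hA, half_lt_self hA⟩
    rw [hc', h0, sub_zero, sub_zero]
    positivity
  have hzero : 2 * h c * (a * deriv h c) ^ 2 = 0 := by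
    refine (hG c hcA).unique ((hasDerivAt_const c (G 0)).congr_of_eventuallyEq ?_)
    filter_upwards [isOpen_Ioo.mem_nhds hcA] with r hr
    exact hconst r (Ioo_subset_Icc_self hr)
  simpa [(hpos c hcA).ne', hslope.ne'] using hzero
end
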